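/- In the root system of type E₈ with highest root θ, the number of upper sets Φ of the poset of positive roots (Δ⁺, ≤) such that θ ∉ Φ² (where Φ² = {α + β : α, β ∈ Φ} ∩ Δ⁺) is 256 = 2⁸; equivalently, the Borel subalgebra of the simple Lie algebra of type E₈ has exactly 256 abelian ideals. -/

import Mathlib

/-- The roots of the root system of type `E₈`, realized (scaled by a factor 2) as the integer
vectors `±2eᵢ ± 2eⱼ` (`i ≠ j`) together with the vectors with all coordinates `±1` and an even
number of coordinates equal to `-1`. -/
def E8roots : Set (Fin 8 → ℤ) :=
  {v | (∑ i, v i ^ 2 = 8) ∧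
    ((∀ i, Even (v i)) ∨
      ((∀ i, v i = 1 ∨ v i = -1) ∧
        Even (Finset.univ.filter (fun i => v i = -1)).card))}

/-- A system of positive roots for `E₈`: the roots on which the (generic) linear functional
`v ↦ ∑ i, 2 ^ i * v i` is positive. -/
def E8pos : Set (Fin 8 → ℤ) :=
  {v | v ∈ E8roots ∧ 0 < ∑ i : Fin 8, 2 ^ i.val * v i}

/-- The partial order on positive roots: `α ≤ β` iff `β − α` is a (possibly empty) sum of
positive roots. -/
def rootLe (pos : Set (Fin 8 → ℤ)) (a b : Fin 8 → ℤ) : Prop :=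
  ∃ l : Multiset (Fin 8 → ℤ), (∀ x ∈ l, x ∈ pos) ∧ b = a + l.sum

/-! ### Subsets of an initial segment of `ℕ` subject to pairwise constraints, as bit masks -/

/-- `m` encodes, by its binary digits, a set of natural numbers below `n` that contains
`j` whenever it contains some `k > j` with `r k j`, and that contains no `j < k` with `s k j`. -/
def IsAdmissible (r s : ℕ → ℕ → Bool) (n m : ℕ) : Prop :=
  m < 2 ^ n ∧ ∀ k < n, m.testBit k = true → ∀ j < k,
    (r k j = true → m.testBit j = true) ∧ (s k j = true → m.testBit j = false)

/-- The mask of all `j < k` with `r k j`. -/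
def relMask (r : ℕ → ℕ → Bool) (k : ℕ) : ℕ :=
  Nat.ofBits fun j : Fin k => r k j

/-- The list of all masks `m` with `IsAdmissible r s n m`. -/
def admissibleMasks (r s : ℕ → ℕ → Bool) : ℕ → List ℕ
  | 0 => [0]
  | k + 1 => admissibleMasks r s k ++
      ((admissibleMasks r s k).filter fun m =>
        (m &&& relMask r k == relMask r k) && (m &&& relMask s k == 0)).map (2 ^ k + ·)

theorem and_relMask_eq_self_iff (r : ℕ → ℕ → Bool) (k m : ℕ) :
    m &&& relMask r k = relMask r k ↔ ∀ j < k, r k j = true → m.testBit j = true := by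
  constructor
  · intro h j hj hr
    have := congrArg (Nat.testBit · j) h
    simpa [relMask, Nat.testBit_ofBits_lt _ _ hj, hr] using this
  · intro h
    refine Nat.eq_of_testBit_eq fun j => ?_
    rcases lt_or_ge j k with hj | hj
    · have := h j hj
      simp only [relMask, Nat.testBit_and, Nat.testBit_ofBits_lt _ _ hj]
      cases hr : r k j <;> simp_all
    · simp [relMask, Nat.testBit_ofBits_ge _ _ hj]

theorem and_relMask_eq_zero_iff (s : ℕ → ℕ → Bool) (k m : ℕ) :
    m &&& relMask s k = 0 ↔ ∀ j < k, s k j = true → m.testBit j = false := by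
  constructor
  · intro h j hj hs
    have := congrArg (Nat.testBit · j) h
    simpa [relMask, Nat.testBit_ofBits_lt _ _ hj, hs] using this
  · intro h
    refine Nat.eq_of_testBit_eq fun j => ?_
    rcases lt_or_ge j k with hj | hj
    · have := h j hj
      simp only [relMask, Nat.testBit_and, Nat.testBit_ofBits_lt _ _ hj, Nat.zero_testBit]
      cases hs : s k j <;> simp_all
    · simp [relMask, Nat.testBit_ofBits_ge _ _ hj]

theorem isAdmissible_succ_of_lt (r s : ℕ → ℕ → Bool) {n m : ℕ} (hm : m < 2 ^ n) :
    IsAdmissible r s (n + 1) m ↔ IsAdmissible r s n m := by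
  have hlt : m < 2 ^ (n + 1) := hm.trans (Nat.pow_lt_pow_right one_lt_two n.lt_succ_self)
  constructor
  · exact fun h => ⟨hm, fun k hk => h.2 k (hk.trans n.lt_succ_self)⟩
  · refine fun h => ⟨hlt, fun k hk hb => ?_⟩
    rcases Nat.lt_succ_iff_lt_or_eq.1 hk with hk | rfl
    · exact h.2 k hk hb
    · simp [Nat.testBit_lt_two_pow hm] at hb

theorem isAdmissible_succ_two_pow_add (r s : ℕ → ℕ → Bool) {n m : ℕ} (hm : m < 2 ^ n) :
    IsAdmissible r s (n + 1) (2 ^ n + m) ↔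
      IsAdmissible r s n m ∧ m &&& relMask r n = relMask r n ∧ m &&& relMask s n = 0 := by
  rw [and_relMask_eq_self_iff, and_relMask_eq_zero_iff]
  have hbit : ∀ j < n, (2 ^ n + m).testBit j = m.testBit j := fun j hj =>
    Nat.testBit_two_pow_add_gt hj m
  have htop : (2 ^ n + m).testBit n = true := by
    simp [Nat.testBit_two_pow_add_eq, Nat.testBit_lt_two_pow hm]
  constructor
  · intro h
    refine ⟨⟨hm, fun k hk hb j hj => ?_⟩, fun j hj => ?_, fun j hj => ?_⟩
    · have := h.2 k (hk.trans n.lt_succ_self) (by rwa [hbit k hk]) j hj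
      rwa [hbit j (hj.trans hk)] at this
    · have := (h.2 n n.lt_succ_self htop j hj).1
      rwa [hbit j hj] at this
    · have := (h.2 n n.lt_succ_self htop j hj).2
      rwa [hbit j hj] at this
  · rintro ⟨h, hr, hs⟩
    refine ⟨by rw [pow_succ]; omega, fun k hk hb j hj => ?_⟩
    rcases Nat.lt_succ_iff_lt_or_eq.1 hk with hk | rfl
    · rw [hbit k hk] at hb
      rw [hbit j (hj.trans hk)]
      exact h.2 k hk hb j hj
    · rw [hbit j hj]
      exact ⟨hr j hj, hs j hj⟩

theorem mem_admissibleMasks (r s : ℕ → ℕ → Bool) (n m : ℕ) :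
    m ∈ admissibleMasks r s n ↔ IsAdmissible r s n m := by
  induction n generalizing m with
  | zero => simp [admissibleMasks, IsAdmissible]
  | succ n ih =>
    simp only [admissibleMasks, List.mem_append, List.mem_map, List.mem_filter, ih,
      Bool.and_eq_true, beq_iff_eq]
    constructor
    · rintro (h | ⟨m, ⟨h, hrs⟩, rfl⟩)
      · exact (isAdmissible_succ_of_lt r s h.1).2 h
      · exact (isAdmissible_succ_two_pow_add r s h.1).2 ⟨h, hrs⟩
    · intro h
      rcases lt_or_ge m (2 ^ n) with hm | hm
      · exact Or.inl ((isAdmissible_succ_of_lt r s hm).1 h)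
      · obtain ⟨m, rfl⟩ := Nat.exists_eq_add_of_le hm
        have hm : m < 2 ^ n := by have := h.1; rw [pow_succ] at this; omega
        have := (isAdmissible_succ_two_pow_add r s hm).1 h
        exact Or.inr ⟨m, this, rfl⟩

theorem nodup_admissibleMasks (r s : ℕ → ℕ → Bool) (n : ℕ) : (admissibleMasks r s n).Nodup := by
  induction n with
  | zero => simp [admissibleMasks]
  | succ n ih =>
    refine List.Nodup.append ih ((ih.filter _).map fun a b h => Nat.add_left_cancel h) ?_
    intro m hm hm'
    obtain ⟨a, -, rfl⟩ := List.mem_map.1 hm'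
    have := ((mem_admissibleMasks r s n _).1 hm).1
    omega

theorem ncard_setOf_isAdmissible (r s : ℕ → ℕ → Bool) (n : ℕ) :
    {m | IsAdmissible r s n m}.ncard = (admissibleMasks r s n).length := by
  have : {m | IsAdmissible r s n m} = ((admissibleMasks r s n).toFinset : Set ℕ) := by
    ext m
    simp [mem_admissibleMasks]
  rw [this, Set.ncard_coe_finset, List.toFinset_card_of_nodup (nodup_admissibleMasks r s n)]

/-! ### The positive roots of `E₈` in coordinates with respect to the simple roots -/

namespace E8

/-- The simple roots, in the order of Bourbaki. -/
def simple : Matrix (Fin 8) (Fin 8) ℤ :=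
  !![1, -1, -1, -1, -1, -1, -1, 1;
    2, 2, 0, 0, 0, 0, 0, 0;
    -2, 2, 0, 0, 0, 0, 0, 0;
    0, -2, 2, 0, 0, 0, 0, 0;
    0, 0, -2, 2, 0, 0, 0, 0;
    0, 0, 0, -2, 2, 0, 0, 0;
    0, 0, 0, 0, -2, 2, 0, 0;
    0, 0, 0, 0, 0, -2, 2, 0]

/-- The positive roots in decreasing lexicographic order; the decimal digits of an
entry, read from the right, are the coefficients of the simple roots. -/
def codes : List ℕ := [
   23456432, 13456432, 12456432, 12356432, 12346432, 12345432, 12345422, 12345332,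
   12345331, 12345322, 12345321, 12344322, 12344321, 12344221, 12334322, 12334321,
   12334221, 12333221, 12333211, 12234322, 12234321, 12234221, 12233221, 12233211,
   12223221, 12223211, 12222211, 12222111, 12222110, 11234322, 11234321, 11234221,
   11233221, 11233211, 11223221, 11223211, 11222211, 11222111, 11222110, 11123221,
   11123211, 11122211, 11122111, 11122110, 11112211, 11112111, 11112110, 11111111,
   11111110, 11111101, 11111100, 11111010, 11111000, 11110000, 11100000, 11000000,
   10000000, 1234322, 1234321, 1234221, 1233221, 1233211, 1223221, 1223211,
   1222211, 1222111, 1222110, 1123221, 1123211, 1122211, 1122111, 1122110,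
   1112211, 1112111, 1112110, 1111111, 1111110, 1111101, 1111100, 1111010,
   1111000, 1110000, 1100000, 1000000, 123221, 123211, 122211, 122111,
   122110, 112211, 112111, 112110, 111111, 111110, 111101, 111100,
   111010, 111000, 110000, 100000, 12211, 12111, 12110, 11111,
   11110, 11101, 11100, 11010, 11000, 10000, 1111, 1110,
   1101, 1100, 1010, 1000, 101, 100, 10, 1]

/-- The coefficient of the `i`-th simple root in the `k`-th positive root. -/
def coeff (k : ℕ) (i : Fin 8) : ℕ := codes.getD k 0 / 10 ^ (i : ℕ) % 10

/-- The `k`-th positive root. -/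
def root (k : ℕ) : Fin 8 → ℤ := Matrix.vecMul (fun i => (coeff k i : ℤ)) simple

/-- The comparison of the `k`-th and the `j`-th positive root. -/
def le (k j : ℕ) : Bool := (List.finRange 8).all fun i => Nat.ble (coeff k i) (coeff j i)

/-- Whether the `k`-th and the `j`-th positive root add up to the highest root. -/
def compl (k j : ℕ) : Bool :=
  (List.finRange 8).all fun i => Nat.beq (coeff k i + coeff j i) (coeff 0 i)

theorem length_admissibleMasks : (admissibleMasks le compl 120).length = 256 := by
  decide +kernel

theorem codes_pairwise : codes.Pairwise (· > ·) := by
  decide +kernel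

theorem codes_eq_sum {k : ℕ} (hk : k < 120) :
    codes.getD k 0 = ∑ i, coeff k i * 10 ^ (i : ℕ) := by
  have : ∀ k < 120, codes.getD k 0 = ∑ i, coeff k i * 10 ^ (i : ℕ) := by decide +kernel
  exact this k hk

theorem exists_root_eq_simple (i : Fin 8) : ∃ k < 120, root k = simple i := by
  have : ∀ i, ∃ k < 120, root k = simple i := by decide +kernel
  exact this i

theorem root_mem_E8pos {k : ℕ} (hk : k < 120) : root k ∈ E8pos := by
  have : ∀ k < 120, ((∑ i, root k i ^ 2 = 8) ∧
      ((∀ i, Even (root k i)) ∨ ((∀ i, root k i = 1 ∨ root k i = -1) ∧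
        Even (Finset.univ.filter (fun i => root k i = -1)).card))) ∧
      0 < ∑ i : Fin 8, 2 ^ i.val * root k i := by
    decide +kernel
  exact this k hk

theorem exists_root_eq_of_even :
    ∀ a ∈ [-2, 0, 2], ∀ b ∈ [-2, 0, 2], ∀ c ∈ [-2, 0, 2], ∀ d ∈ [-2, 0, 2],
    ∀ e ∈ [-2, 0, 2], ∀ f ∈ [-2, 0, 2], ∀ g ∈ [-2, 0, 2], ∀ h ∈ [-2, 0, (2 : ℤ)],
    a ^ 2 + b ^ 2 + c ^ 2 + d ^ 2 + e ^ 2 + f ^ 2 + g ^ 2 + h ^ 2 = 8 →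
    0 < ∑ i : Fin 8, 2 ^ i.val * ![a, b, c, d, e, f, g, h] i →
    ∃ k < 120, root k = ![a, b, c, d, e, f, g, h] := by
  decide +kernel

theorem exists_root_eq_of_odd : ∀ a ∈ [-1, 1], ∀ b ∈ [-1, 1], ∀ c ∈ [-1, 1], ∀ d ∈ [-1, 1],
    ∀ e ∈ [-1, 1], ∀ f ∈ [-1, 1], ∀ g ∈ [-1, 1], ∀ h ∈ [-1, (1 : ℤ)],
    Even (Finset.univ.filter (fun i => ![a, b, c, d, e, f, g, h] i = -1)).card →
    0 < ∑ i : Fin 8, 2 ^ i.val * ![a, b, c, d, e, f, g, h] i →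
    ∃ k < 120, root k = ![a, b, c, d, e, f, g, h] := by
  decide +kernel

theorem le_iff (k j : ℕ) : le k j = true ↔ ∀ i, coeff k i ≤ coeff j i := by
  simp [le]

theorem compl_iff (k j : ℕ) : compl k j = true ↔ ∀ i, coeff k i + coeff j i = coeff 0 i := by
  simp [compl]

theorem le_of_le {k j : ℕ} (hk : k < 120) (hj : j < 120) (h : le k j = true) : j ≤ k := by
  have hle : codes.getD k 0 ≤ codes.getD j 0 := by
    rw [codes_eq_sum hk, codes_eq_sum hj]
    exact Finset.sum_le_sum fun i _ => Nat.mul_le_mul_right _ ((le_iff k j).1 h i)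
  by_contra! hkj
  have hlen : codes.length = 120 := rfl
  have hlt := List.pairwise_iff_getElem.1 codes_pairwise k j (by omega) (by omega) hkj
  rw [List.getD_eq_getElem _ _ (by omega), List.getD_eq_getElem _ _ (by omega)] at hle
  omega

theorem vecMul_simple_injective :
    Function.Injective fun c : Fin 8 → ℤ => Matrix.vecMul c simple := by
  intro c d h
  have h' (j : Fin 8) : ∑ i, c i * simple i j = ∑ i, d i * simple i j := congrFun h j
  simp only [Fin.sum_univ_eight] at h'
  have h0 : c 0 = d 0 := by simpa [simple] using h' 7
  have h7 : c 7 = d 7 := by simpa [simple, h0] using h' 6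
  have h6 : c 6 = d 6 := by simpa [simple, h0, h7] using h' 5
  have h5 : c 5 = d 5 := by simpa [simple, h0, h6] using h' 4
  have h4 : c 4 = d 4 := by simpa [simple, h0, h5] using h' 3
  have h3 : c 3 = d 3 := by simpa [simple, h0, h4] using h' 2
  have e1 : c 1 * 2 + c 2 * 2 = d 1 * 2 + d 2 * 2 := by
    have := h' 1
    simp [simple] at this
    linarith
  have e2 : c 1 * 2 - c 2 * 2 = d 1 * 2 - d 2 * 2 := by
    have := h' 0
    simp [simple] at this
    linarith
  have h1 : c 1 = d 1 := by linarith
  have h2 : c 2 = d 2 := by linarith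
  funext i
  fin_cases i <;> assumption

theorem root_injective {k j : ℕ} (hk : k < 120) (hj : j < 120) (h : root k = root j) : k = j := by
  have hc := congrFun (vecMul_simple_injective h)
  have hc' : ∀ i, coeff k i = coeff j i := fun i => by exact_mod_cast hc i
  exact le_antisymm (le_of_le hj hk ((le_iff j k).2 fun i => (hc' i).ge))
    (le_of_le hk hj ((le_iff k j).2 fun i => (hc' i).le))

theorem root_add_root_eq_iff (k j : ℕ) : root k + root j = root 0 ↔ compl k j = true := by
  rw [compl_iff, root, root, root, ← Matrix.add_vecMul, vecMul_simple_injective.eq_iff,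
    funext_iff]
  simp only [Pi.add_apply]
  norm_cast

theorem mem_E8pos_iff (v : Fin 8 → ℤ) : v ∈ E8pos ↔ ∃ k < 120, root k = v := by
  constructor
  · rintro ⟨⟨hsq, hev | ⟨hodd, hcard⟩⟩, hpos⟩
    · have hmem : ∀ i, v i ∈ [-2, 0, (2 : ℤ)] := by
        intro i
        have hle : v i ^ 2 ≤ 8 := hsq ▸
          Finset.single_le_sum (f := fun i => v i ^ 2) (fun j _ => sq_nonneg _)
            (Finset.mem_univ i)
        obtain ⟨r, hr⟩ := hev i
        have h1 : -3 < v i := by nlinarith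
        have h2 : v i < 3 := by nlinarith
        simp only [List.mem_cons, List.not_mem_nil, or_false]
        omega
      rw [Fin.sum_univ_eight] at hsq
      have hv : ![v 0, v 1, v 2, v 3, v 4, v 5, v 6, v 7] = v := by
        funext i; fin_cases i <;> rfl
      have := exists_root_eq_of_even _ (hmem 0) _ (hmem 1) _ (hmem 2) _ (hmem 3) _ (hmem 4) _ (hmem 5)
        _ (hmem 6) _ (hmem 7) hsq (by rwa [hv])
      rwa [hv] at this
    · have hmem : ∀ i, v i ∈ [-1, (1 : ℤ)] := by
        intro i
        have := hodd i
        simp only [List.mem_cons, List.not_mem_nil, or_false]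
        omega
      have hv : ![v 0, v 1, v 2, v 3, v 4, v 5, v 6, v 7] = v := by
        funext i; fin_cases i <;> rfl
      have := exists_root_eq_of_odd _ (hmem 0) _ (hmem 1) _ (hmem 2) _ (hmem 3) _ (hmem 4) _ (hmem 5)
        _ (hmem 6) _ (hmem 7) (by rwa [hv]) (by rwa [hv])
      rwa [hv] at this
  · rintro ⟨k, hk, rfl⟩
    exact root_mem_E8pos hk

theorem sum_eq_vecMul_of_forall_mem_E8pos (l : Multiset (Fin 8 → ℤ)) (hl : ∀ x ∈ l, x ∈ E8pos) :
    ∃ d : Fin 8 → ℤ, 0 ≤ d ∧ l.sum = Matrix.vecMul d simple := by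
  induction l using Multiset.induction with
  | empty => exact ⟨0, le_rfl, by simp⟩
  | cons a l ih =>
    obtain ⟨d, hd, hsum⟩ := ih fun x hx => hl x (Multiset.mem_cons_of_mem hx)
    obtain ⟨k, -, rfl⟩ := (mem_E8pos_iff a).1 (hl a (Multiset.mem_cons_self a l))
    refine ⟨(fun i => (coeff k i : ℤ)) + d, add_nonneg (fun i => by simp) hd, ?_⟩
    rw [Multiset.sum_cons, hsum, Matrix.add_vecMul, root]

theorem rootLe_root_iff (k j : ℕ) : rootLe E8pos (root k) (root j) ↔ le k j = true := by
  rw [le_iff]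
  constructor
  · rintro ⟨l, hl, h⟩
    obtain ⟨d, hd, hsum⟩ := sum_eq_vecMul_of_forall_mem_E8pos l hl
    rw [hsum, root, root, ← Matrix.add_vecMul, vecMul_simple_injective.eq_iff] at h
    intro i
    have h1 := congrFun h i
    have h2 := hd i
    simp only [Pi.add_apply, Pi.zero_apply] at h1 h2
    omega
  · intro h
    refine ⟨∑ i, Multiset.replicate (coeff j i - coeff k i) (simple i), ?_, ?_⟩
    · intro x hx
      obtain ⟨i, -, hi⟩ := Multiset.mem_sum.1 hx
      rw [Multiset.eq_of_mem_replicate hi]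
      exact (mem_E8pos_iff _).2 (exists_root_eq_simple i)
    · have : (∑ i, Multiset.replicate (coeff j i - coeff k i) (simple i)).sum =
          Matrix.vecMul (fun i => (coeff j i : ℤ) - coeff k i) simple := by
        rw [Multiset.sum_sum, Matrix.vecMul_eq_sum]
        refine Finset.sum_congr rfl fun i _ => ?_
        rw [Multiset.sum_replicate, ← natCast_zsmul, Nat.cast_sub (h i)]
      rw [this, root, root, ← Matrix.add_vecMul]
      congr 1
      funext i
      simp

theorem eq_root_zero {θ : Fin 8 → ℤ} (hmem : θ ∈ E8pos) (h : ∀ α ∈ E8pos, rootLe E8pos α θ) :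
    θ = root 0 := by
  obtain ⟨k, hk, rfl⟩ := (mem_E8pos_iff θ).1 hmem
  have h0 := (rootLe_root_iff 0 k).1 (h _ (root_mem_E8pos (by norm_num)))
  rw [Nat.le_zero.1 (le_of_le (by norm_num) hk h0)]

theorem not_compl_self (k : ℕ) : compl k k ≠ true := by
  rw [Ne, compl_iff]
  intro h
  have h1 := h 1
  have : coeff 0 1 = 3 := rfl
  omega

theorem isAdmissible_le_compl_iff (m : ℕ) :
    IsAdmissible le compl 120 m ↔ m < 2 ^ 120 ∧
      (∀ k < 120, m.testBit k = true → ∀ j < 120, le k j = true → m.testBit j = true) ∧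
      ∀ k < 120, m.testBit k = true → ∀ j < 120, m.testBit j = true → compl k j ≠ true := by
  constructor
  · rintro ⟨hm, h⟩
    refine ⟨hm, fun k hk hbk j hj hle => ?_, fun k hk hbk j hj hbj hc => ?_⟩
    · rcases (le_of_le hk hj hle).eq_or_lt with rfl | hjk
      · exact hbk
      · exact (h k hk hbk j hjk).1 hle
    · rcases lt_trichotomy k j with hkj | rfl | hjk
      · have hc' : compl j k = true := by
          rw [← root_add_root_eq_iff] at hc ⊢
          rwa [add_comm]
        simp [(h j hj hbj k hkj).2 hc'] at hbk
      · exact not_compl_self k hc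
      · simp [(h k hk hbk j hjk).2 hc] at hbj
  · rintro ⟨hm, hr, hs⟩
    refine ⟨hm, fun k hk hbk j hj => ⟨hr k hk hbk j (hj.trans hk), fun hc => ?_⟩⟩
    by_contra hbj
    exact hs k hk hbk j (hj.trans hk) (by simpa using hbj) hc

/-- The set of positive roots whose indices are the positions of the binary digits `1` of `m`. -/
def rootSet (m : ℕ) : Set (Fin 8 → ℤ) :=
  {v | ∃ k < 120, m.testBit k = true ∧ root k = v}

theorem root_mem_rootSet_iff {k : ℕ} (hk : k < 120) (m : ℕ) :
    root k ∈ rootSet m ↔ m.testBit k = true := by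
  constructor
  · rintro ⟨j, hj, hb, h⟩
    rwa [← root_injective hj hk h]
  · exact fun h => ⟨k, hk, h, rfl⟩

theorem rootSet_injOn {m m' : ℕ} (hm : m < 2 ^ 120) (hm' : m' < 2 ^ 120)
    (h : rootSet m = rootSet m') : m = m' := by
  refine Nat.eq_of_testBit_eq fun k => ?_
  rcases lt_or_ge k 120 with hk | hk
  · rw [Bool.eq_iff_iff, ← root_mem_rootSet_iff hk, ← root_mem_rootSet_iff hk, h]
  · have hpow : 2 ^ 120 ≤ 2 ^ k := Nat.pow_le_pow_right two_pos hk
    rw [Nat.testBit_lt_two_pow (hm.trans_le hpow), Nat.testBit_lt_two_pow (hm'.trans_le hpow)]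

theorem exists_rootSet_eq {Φ : Set (Fin 8 → ℤ)} (h : Φ ⊆ E8pos) :
    ∃ m < 2 ^ 120, rootSet m = Φ := by
  classical
  refine ⟨Nat.ofBits fun k : Fin 120 => decide (root k ∈ Φ), Nat.ofBits_lt_two_pow _, ?_⟩
  ext v
  constructor
  · rintro ⟨k, hk, hb, rfl⟩
    simpa [Nat.testBit_ofBits_lt _ _ hk] using hb
  · intro hv
    obtain ⟨k, hk, rfl⟩ := (mem_E8pos_iff v).1 (h hv)
    exact ⟨k, hk, by simpa [Nat.testBit_ofBits_lt _ _ hk] using hv, rfl⟩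

theorem isAdmissible_iff_rootSet {m : ℕ} (hm : m < 2 ^ 120) :
    IsAdmissible le compl 120 m ↔
      (∀ α ∈ rootSet m, ∀ β ∈ E8pos, rootLe E8pos α β → β ∈ rootSet m) ∧
      root 0 ∉ {γ | ∃ α ∈ rootSet m, ∃ β ∈ rootSet m, γ = α + β} ∩ E8pos := by
  rw [isAdmissible_le_compl_iff]
  constructor
  · rintro ⟨-, hr, hs⟩
    constructor
    · rintro _ ⟨k, hk, hb, rfl⟩ β hβ hle
      obtain ⟨j, hj, rfl⟩ := (mem_E8pos_iff β).1 hβ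
      exact (root_mem_rootSet_iff hj m).2 (hr k hk hb j hj ((rootLe_root_iff k j).1 hle))
    · rintro ⟨⟨_, ⟨k, hk, hbk, rfl⟩, _, ⟨j, hj, hbj, rfl⟩, h⟩, -⟩
      exact hs k hk hbk j hj hbj ((root_add_root_eq_iff k j).1 h.symm)
  · rintro ⟨hr, hs⟩
    refine ⟨hm, fun k hk hb j hj hle => ?_, fun k hk hbk j hj hbj hc => hs ⟨?_, ?_⟩⟩
    · exact (root_mem_rootSet_iff hj m).1 (hr _ ⟨k, hk, hb, rfl⟩ _ (root_mem_E8pos hj)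
        ((rootLe_root_iff k j).2 hle))
    · exact ⟨_, ⟨k, hk, hbk, rfl⟩, _, ⟨j, hj, hbj, rfl⟩, ((root_add_root_eq_iff k j).2 hc).symm⟩
    · exact root_mem_E8pos (by norm_num)

end E8

/-- In the root system of type `E₈` with highest root `θ`, the number of
upper sets `Φ` of the poset of positive roots `(Δ⁺, ≤)` such that `θ ∉ Φ²` (where
`Φ² = {α + β : α, β ∈ Φ} ∩ Δ⁺`) is `256 = 2⁸`; equivalently, the Borel subalgebra of the
simple Lie algebra of type `E₈` has exactly `256` abelian ideals. -/
theorem stmt16 (θ : Fin 8 → ℤ)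
    (hθ : θ ∈ E8pos ∧ ∀ α ∈ E8pos, rootLe E8pos α θ) :
    {Φ : Set (Fin 8 → ℤ) | Φ ⊆ E8pos ∧
      (∀ α ∈ Φ, ∀ β ∈ E8pos, rootLe E8pos α β → β ∈ Φ) ∧
      θ ∉ {γ | ∃ α ∈ Φ, ∃ β ∈ Φ, γ = α + β} ∩ E8pos}.ncard = 256 := by
  obtain rfl := E8.eq_root_zero hθ.1 hθ.2
  rw [← E8.length_admissibleMasks, ← ncard_setOf_isAdmissible,
    ← Set.InjOn.ncard_image (f := E8.rootSet) fun m hm m' hm' h =>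
      E8.rootSet_injOn hm.1 hm'.1 h]
  congr 1
  ext Φ
  constructor
  · rintro ⟨hΦ, h⟩
    obtain ⟨m, hm, rfl⟩ := E8.exists_rootSet_eq hΦ
    exact ⟨m, (E8.isAdmissible_iff_rootSet hm).2 h, rfl⟩
  · rintro ⟨m, hm, rfl⟩
    refine ⟨?_, (E8.isAdmissible_iff_rootSet hm.1).1 hm⟩
    rintro _ ⟨k, hk, -, rfl⟩
    exact E8.root_mem_E8pos hk
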